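/- Let E denote the K×J matrix whose (l,j) entry is μ_j if l = j (for l ≤ J) and 0 otherwise, let G = C M (I − Pᵀ)^{−1} Pᵀ E, assume I + G is invertible, and set R̄ = (I + G)^{−1} and R̃ = A_L − A_{LH} A_H^{−1} A_{HL}. Then the following are equivalent: (i) R = I − Qᵀ is a P-matrix; (ii) R̃ is a P-matrix; (iii) R̄ is a P-matrix. -/

import Mathlib

open Matrix

/-- Embedding of the lowest-priority classes `ℒ = {1,…,J}` into the classes `𝒦 = {1,…,K}`. -/
def emb {K J : ℕ} (hJK : J ≤ K) (j : Fin J) : Fin K := Fin.castLE hJK j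

/-- The set `ℋ = {J+1,…,K}` of higher-priority classes, as a subtype of `Fin K`. -/
abbrev Hty (K J : ℕ) := {l : Fin K // J ≤ (l : ℕ)}

/-- The matrix `B` with `B_{k,k⁺} = 1` and all other entries `0`: entry `(i, c)` is `1`
iff `c ∈ ℋ` and `i = c⁻ = prev c`. -/
def Bmat (K J : ℕ) (prev : Fin K → Fin K) : Matrix (Fin K) (Fin K) ℝ :=
  Matrix.of fun i c => if J ≤ (c : ℕ) ∧ prev c = i then 1 else 0

/-- `A = (I - Pᵀ) diag(μ) (I - B)`. -/
noncomputable def Amat (K J : ℕ) (P : Matrix (Fin K) (Fin K) ℝ) (μ : Fin K → ℝ)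
    (prev : Fin K → Fin K) : Matrix (Fin K) (Fin K) ℝ :=
  (1 - Pᵀ) * Matrix.diagonal μ * (1 - Bmat K J prev)

/-- The `(ℋ,ℋ)` block `A_H` of `A`. -/
noncomputable def AHmat (K J : ℕ) (P : Matrix (Fin K) (Fin K) ℝ) (μ : Fin K → ℝ)
    (prev : Fin K → Fin K) : Matrix (Hty K J) (Hty K J) ℝ :=
  Matrix.of fun i j => Amat K J P μ prev i j

/-- The `(ℒ,ℋ)` block `A_{LH}` of `A`. -/
noncomputable def ALHmat {K J : ℕ} (hJK : J ≤ K) (P : Matrix (Fin K) (Fin K) ℝ)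
    (μ : Fin K → ℝ) (prev : Fin K → Fin K) : Matrix (Fin J) (Hty K J) ℝ :=
  Matrix.of fun i j => Amat K J P μ prev (emb hJK i) j

/-- The `(ℋ,ℒ)` block `A_{HL}` of `A`. -/
noncomputable def AHLmat {K J : ℕ} (hJK : J ≤ K) (P : Matrix (Fin K) (Fin K) ℝ)
    (μ : Fin K → ℝ) (prev : Fin K → Fin K) : Matrix (Hty K J) (Fin J) ℝ :=
  Matrix.of fun i j => Amat K J P μ prev i (emb hJK j)

/-- The `(ℒ,ℒ)` block `A_L` of `A`. -/
noncomputable def ALmat {K J : ℕ} (hJK : J ≤ K) (P : Matrix (Fin K) (Fin K) ℝ)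
    (μ : Fin K → ℝ) (prev : Fin K → Fin K) : Matrix (Fin J) (Fin J) ℝ :=
  Matrix.of fun i j => Amat K J P μ prev (emb hJK i) (emb hJK j)

/-- `Q = P_L - P_{LH} A_H^{-⊤} A_{LH}ᵀ`. -/
noncomputable def Qmat {K J : ℕ} (hJK : J ≤ K) (P : Matrix (Fin K) (Fin K) ℝ)
    (μ : Fin K → ℝ) (prev : Fin K → Fin K) : Matrix (Fin J) (Fin J) ℝ :=
  (Matrix.of fun i j => P (emb hJK i) (emb hJK j)) -
    (Matrix.of fun (i : Fin J) (h : Hty K J) => P (emb hJK i) h) *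
      ((AHmat K J P μ prev)⁻¹)ᵀ * (ALHmat hJK P μ prev)ᵀ

/-- The principal submatrix `Q_{1:k-1,1:k-1}` (indices strictly below `k`). -/
noncomputable def Qlow {J : ℕ} (Q : Matrix (Fin J) (Fin J) ℝ) (k : Fin J) :
    Matrix {i : Fin J // i < k} {i : Fin J // i < k} ℝ :=
  Matrix.of fun i j => Q i j

/-- `w_{1:k-1,k} = (I - Q_{1:k-1,1:k-1})⁻¹ Q_{1:k-1,k}`. -/
noncomputable def wLow {J : ℕ} (Q : Matrix (Fin J) (Fin J) ℝ) (k : Fin J) :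
    {i : Fin J // i < k} → ℝ :=
  ((1 - Qlow Q k)⁻¹).mulVec fun j => Q j k

/-- `w_{jk} = Q_{jk} + Q_{j,1:k-1}(I - Q_{1:k-1,1:k-1})⁻¹ Q_{1:k-1,k}` (rows `j = k,…,J`). -/
noncomputable def wHigh {J : ℕ} (Q : Matrix (Fin J) (Fin J) ℝ) (k : Fin J) (j : Fin J) : ℝ :=
  Q j k + ∑ l : {l : Fin J // l < k}, Q j l * wLow Q k l

/-- `u_L^{(k)} = (w_{1k},…,w_{k-1,k}, 1, 0,…,0)ᵀ ∈ ℝ^J`. -/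
noncomputable def uLvec {J : ℕ} (Q : Matrix (Fin J) (Fin J) ℝ) (k : Fin J) : Fin J → ℝ :=
  fun i => if h : i < k then wLow Q k ⟨i, h⟩ else if i = k then 1 else 0

/-- `u_H^{(k)} = -A_H^{-⊤} A_{LH}ᵀ u_L^{(k)}`, for a given `ℒ`-block `uL`. -/
noncomputable def uHvec {K J : ℕ} (hJK : J ≤ K) (P : Matrix (Fin K) (Fin K) ℝ)
    (μ : Fin K → ℝ) (prev : Fin K → Fin K) (uL : Fin J → ℝ) : Hty K J → ℝ :=
  -(((AHmat K J P μ prev)⁻¹)ᵀ.mulVec ((ALHmat hJK P μ prev)ᵀ.mulVec uL))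

/-- The vector `u ∈ ℝ^K` with `ℒ`-block `uL` and `ℋ`-block `-A_H^{-⊤} A_{LH}ᵀ uL`. -/
noncomputable def uvec {K J : ℕ} (hJK : J ≤ K) (P : Matrix (Fin K) (Fin K) ℝ)
    (μ : Fin K → ℝ) (prev : Fin K → Fin K) (uL : Fin J → ℝ) : Fin K → ℝ :=
  fun l => if h : (l : ℕ) < J then uL ⟨l, h⟩
    else uHvec hJK P μ prev uL ⟨l, Nat.le_of_not_lt h⟩

/-- A square real matrix is a `P`-matrix if all of its principal minors are positive. -/
def IsPMatrix {n : Type*} [Fintype n] [DecidableEq n] (M : Matrix n n ℝ) : Prop :=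
  ∀ S : Finset n, S.Nonempty →
    0 < (M.submatrix (fun i : S => (i : n)) (fun j : S => (j : n))).det

/-- The constituency matrix `C`, with `C_{jk} = 1` iff `s(k) = j`. -/
def Cmat (K J : ℕ) (s : Fin K → Fin J) : Matrix (Fin J) (Fin K) ℝ :=
  Matrix.of fun j l => if s l = j then 1 else 0

/-- The `K×J` matrix `E` whose `(l,j)` entry is `μ_j` if `l = j` (for `l ≤ J`) and `0`
otherwise. -/
def Emat {K J : ℕ} (hJK : J ≤ K) (μ : Fin K → ℝ) : Matrix (Fin K) (Fin J) ℝ :=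
  Matrix.of fun l j => if l = emb hJK j then μ l else 0

theorem isPMatrix_diagonal_mul_iff {n : Type*} [Fintype n] [DecidableEq n] {d : n → ℝ}
    (hd : ∀ i, 0 < d i) (M : Matrix n n ℝ) :
    IsPMatrix (diagonal d * M) ↔ IsPMatrix M := by
  refine forall_congr' fun S => forall_congr' fun _ => ?_
  have h : (diagonal d * M).submatrix (fun i : S => (i : n)) (fun j : S => (j : n)) =
      diagonal (fun i : S => d i) *
        M.submatrix (fun i : S => (i : n)) (fun j : S => (j : n)) := by
    ext i j
    simp [diagonal_mul]
  rw [h, det_mul, det_diagonal]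
  exact mul_pos_iff_of_pos_left (Finset.prod_pos fun i _ => hd i)

theorem isPMatrix_mul_diagonal_iff {n : Type*} [Fintype n] [DecidableEq n] {d : n → ℝ}
    (hd : ∀ i, 0 < d i) (M : Matrix n n ℝ) :
    IsPMatrix (M * diagonal d) ↔ IsPMatrix M := by
  refine forall_congr' fun S => forall_congr' fun _ => ?_
  have h : (M * diagonal d).submatrix (fun i : S => (i : n)) (fun j : S => (j : n)) =
      M.submatrix (fun i : S => (i : n)) (fun j : S => (j : n)) *
        diagonal (fun i : S => d i) := by
    ext i j
    simp [mul_diagonal]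
  rw [h, det_mul, det_diagonal]
  exact mul_pos_iff_of_pos_right (Finset.prod_pos fun i _ => hd i)

theorem sum_eq_sum_emb_add_sum_Hty {K J : ℕ} (hJK : J ≤ K) (f : Fin K → ℝ) :
    ∑ l, f l = ∑ j : Fin J, f (emb hJK j) + ∑ h : Hty K J, f h := by
  classical
  rw [← Fintype.sum_subtype_add_sum_subtype (fun l : Fin K => (l : ℕ) < J) f]
  congr 1
  · exact (Fintype.sum_equiv (Fin.castLEquiv hJK) _ _ fun j => rfl).symm
  · exact Fintype.sum_equiv (Equiv.subtypeEquivRight fun l => not_lt) _ _ fun h => rfl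

theorem mul_eq_emb_add_Hty {K J : ℕ} (hJK : J ≤ K) {m n : Type*}
    (M : Matrix m (Fin K) ℝ) (N : Matrix (Fin K) n ℝ) :
    M * N = M.submatrix id (emb hJK) * N.submatrix (emb hJK) id +
      M.submatrix id (Subtype.val : Hty K J → Fin K) *
        N.submatrix (Subtype.val : Hty K J → Fin K) id := by
  ext i j
  simp [mul_apply, sum_eq_sum_emb_add_sum_Hty hJK]

theorem emb_ne_of_le {K J : ℕ} (hJK : J ≤ K) (j : Fin J) {l : Fin K} (hl : J ≤ (l : ℕ)) :
    l ≠ emb hJK j := by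
  rintro rfl
  exact absurd j.isLt (not_lt.mpr hl)

theorem Amat_apply_emb {K J : ℕ} (hJK : J ≤ K) (P : Matrix (Fin K) (Fin K) ℝ)
    (μ : Fin K → ℝ) (prev : Fin K → Fin K) (i : Fin K) (j : Fin J) :
    Amat K J P μ prev i (emb hJK j) = (1 - Pᵀ) i (emb hJK j) * μ (emb hJK j) := by
  have hB : ∀ l, Bmat K J prev l (emb hJK j) = 0 := fun l => by
    simp [Bmat, emb]
  rw [Amat, mul_sub, mul_one, Matrix.sub_apply, mul_diagonal, Matrix.mul_apply]
  simp [hB]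

/-- The Schur complement `R̃` is `R = I - Qᵀ` with its columns scaled by `μ`. -/
theorem schur_eq_one_sub_Qmat_transpose_mul_diagonal {K J : ℕ} (hJK : J ≤ K)
    (P : Matrix (Fin K) (Fin K) ℝ) (μ : Fin K → ℝ) (prev : Fin K → Fin K) :
    ALmat hJK P μ prev - ALHmat hJK P μ prev * (AHmat K J P μ prev)⁻¹ * AHLmat hJK P μ prev =
      (1 - (Qmat hJK P μ prev)ᵀ) * diagonal fun j => μ (emb hJK j) := by
  have hL : ALmat hJK P μ prev =
      (1 - (Matrix.of fun i j => P (emb hJK i) (emb hJK j))ᵀ) *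
        diagonal fun j => μ (emb hJK j) := by
    ext i j
    rw [mul_diagonal, ALmat, of_apply, Amat_apply_emb]
    simp [Matrix.one_apply, emb]
  have hHL : AHLmat hJK P μ prev =
      -((Matrix.of fun (i : Fin J) (h : Hty K J) => P (emb hJK i) h)ᵀ *
        diagonal fun j => μ (emb hJK j)) := by
    ext i j
    rw [Matrix.neg_apply, mul_diagonal, AHLmat, of_apply, Amat_apply_emb]
    simp [emb_ne_of_le hJK j i.2]
  rw [hL, hHL, Qmat]
  simp only [transpose_sub, transpose_mul, transpose_transpose, Matrix.mul_neg, Matrix.sub_mul,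
    Matrix.mul_assoc]
  abel

theorem Cmat_mul_one_sub_Bmat {K J : ℕ} (hJK : J ≤ K) (s : Fin K → Fin J)
    (prev : Fin K → Fin K) (hs : ∀ j : Fin J, s (emb hJK j) = j)
    (hprev_station : ∀ c : Fin K, J ≤ (c : ℕ) → s (prev c) = s c) :
    Cmat K J s * (1 - Bmat K J prev) =
      Matrix.of fun j c => if c = emb hJK j then 1 else 0 := by
  ext j c
  rw [Matrix.mul_sub, Matrix.mul_one, Matrix.sub_apply, Matrix.mul_apply, of_apply]
  by_cases hc : J ≤ (c : ℕ)
  · simp [Cmat, Bmat, hc, hprev_station c hc, emb_ne_of_le hJK j hc]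
  · obtain ⟨i, rfl⟩ : ∃ i, c = emb hJK i := ⟨⟨c, not_le.mp hc⟩, rfl⟩
    have hij : emb hJK i = emb hJK j ↔ i = j := (Fin.castLE_injective hJK).eq_iff
    simp [Cmat, Bmat, hc, hs, hij]

theorem Cmat_mul_diagonal_inv_mul_Emat {K J : ℕ} (hJK : J ≤ K) (s : Fin K → Fin J)
    (hs : ∀ j : Fin J, s (emb hJK j) = j) (μ : Fin K → ℝ) (hμ : ∀ l, 0 < μ l) :
    Cmat K J s * diagonal (fun l => (μ l)⁻¹) * Emat hJK μ = 1 := by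
  ext i j
  rw [Matrix.mul_apply]
  simp [Cmat, Emat, mul_diagonal, hs, Matrix.one_apply, (hμ _).ne', eq_comm]

/-- If `V * A = [I, 0]`, then the `ℒ`-block of `V` is a left inverse of the Schur
complement `R̃`. -/
theorem submatrix_emb_mul_schur {K J : ℕ} (hJK : J ≤ K) (P : Matrix (Fin K) (Fin K) ℝ)
    (μ : Fin K → ℝ) (prev : Fin K → Fin K) (hAH : IsUnit (AHmat K J P μ prev))
    (V : Matrix (Fin J) (Fin K) ℝ)
    (hV : V * Amat K J P μ prev = Matrix.of fun j c => if c = emb hJK j then 1 else 0) :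
    V.submatrix id (emb hJK) * (ALmat hJK P μ prev -
      ALHmat hJK P μ prev * (AHmat K J P μ prev)⁻¹ * AHLmat hJK P μ prev) = 1 := by
  rw [mul_eq_emb_add_Hty hJK] at hV
  set VL := V.submatrix id (emb hJK)
  set VH := V.submatrix id (Subtype.val : Hty K J → Fin K)
  have h1 : VL * ALmat hJK P μ prev + VH * AHLmat hJK P μ prev = 1 := by
    ext i j
    have h := congrFun (congrFun hV i) (emb hJK j)
    have hij : emb hJK j = emb hJK i ↔ i = j :=
      (Fin.castLE_injective hJK).eq_iff.trans eq_comm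
    rw [Matrix.one_apply]
    simp only [of_apply, hij] at h
    exact h
  have h2 : VL * ALHmat hJK P μ prev + VH * AHmat K J P μ prev = 0 := by
    ext i j
    have h := congrFun (congrFun hV i) j
    rw [of_apply, if_neg (emb_ne_of_le hJK i j.2)] at h
    exact h
  have h3 : VL * ALHmat hJK P μ prev * (AHmat K J P μ prev)⁻¹ = -VH := by
    rw [eq_neg_of_add_eq_zero_left h2, Matrix.neg_mul,
      mul_nonsing_inv_cancel_right _ _ ((isUnit_iff_isUnit_det _).mp hAH)]
  rw [Matrix.mul_sub, ← Matrix.mul_assoc, ← Matrix.mul_assoc, h3, Matrix.neg_mul,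
    sub_neg_eq_add, h1]

theorem stmt12 (K J : ℕ) (hJ : 1 ≤ J) (hJK : J ≤ K)
    (s : Fin K → Fin J) (prev : Fin K → Fin K)
    (hs : ∀ j : Fin J, s (emb hJK j) = j)
    (hprev_station : ∀ c : Fin K, J ≤ (c : ℕ) → s (prev c) = s c)
    (hprev_inj : ∀ c c' : Fin K, J ≤ (c : ℕ) → J ≤ (c' : ℕ) → prev c = prev c' → c = c')
    (hchain : ∀ c : Fin K, ∃ n : ℕ,
      (fun x : Fin K => if J ≤ (x : ℕ) then prev x else x)^[n] c = emb hJK (s c))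
    (P : Matrix (Fin K) (Fin K) ℝ) (hP : IsUnit (1 - P))
    (μ : Fin K → ℝ) (hμ : ∀ l, 0 < μ l)
    (hAH : IsUnit (AHmat K J P μ prev))
    (hG : IsUnit (1 + Cmat K J s * Matrix.diagonal (fun l : Fin K => (μ l)⁻¹) *
      (1 - Pᵀ)⁻¹ * Pᵀ * Emat hJK μ)) :
    -- (i) ↔ (ii): `R = I - Qᵀ` is a P-matrix iff `R̃ = A_L - A_LH A_H⁻¹ A_HL` is
    (IsPMatrix (1 - (Qmat hJK P μ prev)ᵀ) ↔
      IsPMatrix (ALmat hJK P μ prev -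
        ALHmat hJK P μ prev * (AHmat K J P μ prev)⁻¹ * AHLmat hJK P μ prev)) ∧
    -- (ii) ↔ (iii): `R̃` is a P-matrix iff `R̄ = (I + G)⁻¹` is
    (IsPMatrix (ALmat hJK P μ prev -
        ALHmat hJK P μ prev * (AHmat K J P μ prev)⁻¹ * AHLmat hJK P μ prev) ↔
      IsPMatrix ((1 + Cmat K J s * Matrix.diagonal (fun l : Fin K => (μ l)⁻¹) *
        (1 - Pᵀ)⁻¹ * Pᵀ * Emat hJK μ)⁻¹)) := by
  have hd : ∀ j : Fin J, 0 < μ (emb hJK j) := fun j => hμ _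
  have hdet : IsUnit (1 - Pᵀ).det := by
    rw [← transpose_one, ← transpose_sub, det_transpose]
    exact (isUnit_iff_isUnit_det _).mp hP
  set CM := Cmat K J s * diagonal (fun l : Fin K => (μ l)⁻¹) with hCM
  have hMμ : diagonal (fun l : Fin K => (μ l)⁻¹) * diagonal μ = 1 := by
    simp [diagonal_mul_diagonal, (hμ _).ne']
  have hV : CM * (1 - Pᵀ)⁻¹ * Amat K J P μ prev =
      Matrix.of fun j c => if c = emb hJK j then 1 else 0 := by
    rw [Amat, ← Matrix.mul_assoc, ← Matrix.mul_assoc, nonsing_inv_mul_cancel_right _ _ hdet,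
      hCM, Matrix.mul_assoc (Cmat K J s), hMμ, Matrix.mul_one,
      Cmat_mul_one_sub_Bmat hJK s prev hs hprev_station]
  have hG_eq : 1 + CM * (1 - Pᵀ)⁻¹ * Pᵀ * Emat hJK μ =
      (CM * (1 - Pᵀ)⁻¹).submatrix id (emb hJK) * diagonal fun j => μ (emb hJK j) := by
    have hE : (CM * (1 - Pᵀ)⁻¹).submatrix id (emb hJK) * diagonal (fun j => μ (emb hJK j)) =
        CM * (1 - Pᵀ)⁻¹ * Emat hJK μ := by
      ext i j
      rw [mul_diagonal, Matrix.mul_apply]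
      simp [Emat]
    rw [hE, ← Cmat_mul_diagonal_inv_mul_Emat hJK s hs μ hμ, ← hCM, ← Matrix.add_mul]
    congr 1
    calc CM + CM * (1 - Pᵀ)⁻¹ * Pᵀ
        = CM * (1 - Pᵀ)⁻¹ * (1 - Pᵀ) + CM * (1 - Pᵀ)⁻¹ * Pᵀ := by
          rw [nonsing_inv_mul_cancel_right _ _ hdet]
      _ = CM * (1 - Pᵀ)⁻¹ := by rw [← Matrix.mul_add, sub_add_cancel, Matrix.mul_one]
  have hschur := submatrix_emb_mul_schur hJK P μ prev hAH _ hV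
  refine ⟨?_, ?_⟩
  · rw [schur_eq_one_sub_Qmat_transpose_mul_diagonal, isPMatrix_mul_diagonal_iff hd]
  · set R := ALmat hJK P μ prev -
      ALHmat hJK P μ prev * (AHmat K J P μ prev)⁻¹ * AHLmat hJK P μ prev
    have hinv : (1 + CM * (1 - Pᵀ)⁻¹ * Pᵀ * Emat hJK μ)⁻¹ =
        diagonal (fun j => (μ (emb hJK j))⁻¹) * R := by
      apply inv_eq_right_inv
      rw [hG_eq, Matrix.mul_assoc, ← Matrix.mul_assoc (diagonal _) (diagonal _) R,
        diagonal_mul_diagonal]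
      simpa [(hμ _).ne'] using hschur
    rw [hinv, isPMatrix_diagonal_mul_iff fun j => inv_pos.mpr (hd j)]
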